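/- arXiv:0706.1890 — 4 statements merged into one kernel-verified Lean document; each statement's English description precedes it below -/
import Mathlib

section
/- Let λ > 0 and 0 < ρ < 1. For every ε > 0 there exists a₀ > 0 such that for all 0 < a ≤ a₀ and every z ∈ ℂ with 1 + λz ≠ 0 satisfying |z|^{1−ρ}·|z−1|^ρ = a·|1+λz|^ρ, one has |z| < 1 + ε and |z| > (1−ε)·a^{1/(1−ρ)}. (As a → 0 the level curve Γ_a = {z : |w(z)| = a} collapses onto the points z = 0 and z = 1.) -/
/-- Upper bound part. -/
lemma upper_part (lam ρ : ℝ) (hlam : 0 < lam) (hρ0 : 0 < ρ) (hρ1 : ρ < 1)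
    (ε : ℝ) (hε : 0 < ε) (a : ℝ) (ha : 0 < a)
    (ha1 : a < (ε / (1 + ε) / (1 + lam)) ^ ρ) (z : ℂ)
    (h : ‖z‖ ^ (1 - ρ) * ‖z - 1‖ ^ ρ = a * ‖1 + (lam : ℂ) * z‖ ^ ρ) : ‖z‖ < 1 + ε := by
  by_contra! hr
  have h1 : ‖z‖ - 1 ≤ ‖z - 1‖ := by simpa using norm_sub_norm_le z 1
  have h2 : ‖1 + (lam : ℂ) * z‖ ≤ 1 + lam * ‖z‖ := by
    refine (norm_add_le _ _).trans ?_
    simp [abs_of_pos hlam]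
  set r := ‖z‖ with hrdef
  have hr0 : 0 < r := by linarith
  have h3 : ε / (1 + ε) * r ≤ ‖z - 1‖ := by
    refine le_trans ?_ h1
    rw [div_mul_eq_mul_div, div_le_iff₀ (by linarith)]
    nlinarith
  have h4 : ‖1 + (lam : ℂ) * z‖ ≤ (1 + lam) * r := by nlinarith
  have h5 : (1 : ℝ) ≤ r ^ (1 - ρ) := Real.one_le_rpow (by linarith) (by linarith)
  have h6 : (ε / (1 + ε) * r) ^ ρ ≤ ‖z - 1‖ ^ ρ :=
    Real.rpow_le_rpow (by positivity) h3 hρ0.le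
  have h7 : ‖1 + (lam : ℂ) * z‖ ^ ρ ≤ ((1 + lam) * r) ^ ρ :=
    Real.rpow_le_rpow (norm_nonneg _) h4 hρ0.le
  have h8 : (ε / (1 + ε) * r) ^ ρ =
      (ε / (1 + ε) / (1 + lam)) ^ ρ * ((1 + lam) * r) ^ ρ := by
    rw [← Real.mul_rpow (by positivity) (by positivity)]
    congr 1
    field_simp
  have h9 : 0 < ((1 + lam) * r) ^ ρ := by positivity
  have h10 : a * ((1 + lam) * r) ^ ρ < (ε / (1 + ε) * r) ^ ρ := by
    rw [h8]; exact mul_lt_mul_of_pos_right ha1 h9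
  have h11 : a * ‖1 + (lam : ℂ) * z‖ ^ ρ ≤ a * ((1 + lam) * r) ^ ρ :=
    mul_le_mul_of_nonneg_left h7 ha.le
  have h12 : 0 ≤ ‖z - 1‖ ^ ρ := by positivity
  nlinarith

/-- Lower bound part. -/
lemma lower_part (lam ρ : ℝ) (hlam : 0 < lam) (hρ0 : 0 < ρ) (hρ1 : ρ < 1)
    (ε : ℝ) (hε : 0 < ε) (hε1 : ε < 1) (a : ℝ) (ha : 0 < a) (ha1 : a ≤ 1)
    (ha2 : a ≤ (1 - (1 - ε) ^ ((1 - ρ) / ρ)) / (lam + 1)) (z : ℂ)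
    (h : ‖z‖ ^ (1 - ρ) * ‖z - 1‖ ^ ρ = a * ‖1 + (lam : ℂ) * z‖ ^ ρ) :
    (1 - ε) * a ^ (1 / (1 - ρ)) < ‖z‖ := by
  by_contra! hr
  have hs : 0 < 1 - ρ := by linarith
  have he : 0 < 1 - ε := by linarith
  have h1 : ‖z - 1‖ ≤ ‖z‖ + 1 := by simpa using norm_sub_le z 1
  have h2 : 1 - lam * ‖z‖ ≤ ‖1 + (lam : ℂ) * z‖ := by
    have := norm_sub_le (1 + (lam : ℂ) * z) ((lam : ℂ) * z)
    simp [abs_of_pos hlam] at this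
    linarith
  have ht : a ^ (1 / (1 - ρ)) ≤ a := by
    have := Real.rpow_le_rpow_of_exponent_ge ha ha1
      (show (1 : ℝ) ≤ 1 / (1 - ρ) by rw [le_div_iff₀ hs]; linarith)
    simpa using this
  have ht0 : 0 < a ^ (1 / (1 - ρ)) := by positivity
  have hz0 : 0 ≤ ‖z‖ := norm_nonneg z
  have hra : ‖z‖ < a := by nlinarith
  have hpow : ‖z‖ ^ (1 - ρ) ≤ (1 - ε) ^ (1 - ρ) * a := by
    have := Real.rpow_le_rpow hz0 hr hs.le
    rwa [Real.mul_rpow he.le ht0.le, ← Real.rpow_mul ha.le, one_div_mul_cancel hs.ne',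
      Real.rpow_one] at this
  have hd0 : 0 < (1 - ε) ^ ((1 - ρ) / ρ) := by positivity
  have hd1 : (1 - ε) ^ ((1 - ρ) / ρ) < 1 :=
    Real.rpow_lt_one he.le (by linarith) (by positivity)
  have hdp : ((1 - ε) ^ ((1 - ρ) / ρ)) ^ ρ = (1 - ε) ^ (1 - ρ) := by
    rw [← Real.rpow_mul he.le, div_mul_cancel₀ _ hρ0.ne']
  set d := (1 - ε) ^ ((1 - ρ) / ρ)
  rw [le_div_iff₀ (by linarith)] at ha2
  have h3 : d * (‖z‖ + 1) < ‖1 + (lam : ℂ) * z‖ := by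
    refine lt_of_lt_of_le ?_ h2
    nlinarith
  have h4 : (d * (‖z‖ + 1)) ^ ρ < ‖1 + (lam : ℂ) * z‖ ^ ρ :=
    Real.rpow_lt_rpow (by positivity) h3 hρ0
  rw [Real.mul_rpow hd0.le (by positivity), hdp] at h4
  have h5 : ‖z - 1‖ ^ ρ ≤ (‖z‖ + 1) ^ ρ := Real.rpow_le_rpow (norm_nonneg _) h1 hρ0.le
  have h6 : ‖z‖ ^ (1 - ρ) * ‖z - 1‖ ^ ρ ≤ (1 - ε) ^ (1 - ρ) * a * (‖z‖ + 1) ^ ρ := by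
    gcongr
  nlinarith [mul_lt_mul_of_pos_left h4 ha]

/-- as `a → 0` the level curve `Γ_a = {z : |z|^{1-ρ}|z-1|^ρ/|1+λz|^ρ = a}`
collapses onto the points `z = 0` and `z = 1`: every `z ∈ Γ_a` satisfies `|z| < 1 + ε` and
`|z| > (1-ε) a^{1/(1-ρ)}` once `a` is small enough. -/
theorem stmt14 (lam ρ : ℝ) (hlam : 0 < lam) (hρ0 : 0 < ρ) (hρ1 : ρ < 1)
    (ε : ℝ) (hε : 0 < ε) :
    ∃ a₀ > 0, ∀ a : ℝ, 0 < a → a ≤ a₀ → ∀ z : ℂ, 1 + (lam : ℂ) * z ≠ 0 →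
      ‖z‖ ^ (1 - ρ) * ‖z - 1‖ ^ ρ =
        a * ‖1 + (lam : ℂ) * z‖ ^ ρ →
      ‖z‖ < 1 + ε ∧ (1 - ε) * a ^ (1 / (1 - ρ)) < ‖z‖ := by
  have hs : 0 < 1 - ρ := by linarith
  have hA : 0 < (ε / (1 + ε) / (1 + lam)) ^ ρ := by positivity
  by_cases hε1 : ε < 1
  · have he : 0 < 1 - ε := by linarith
    have hd1 : (1 - ε) ^ ((1 - ρ) / ρ) < 1 :=
      Real.rpow_lt_one he.le (by linarith) (by positivity)
    have hB : 0 < (1 - (1 - ε) ^ ((1 - ρ) / ρ)) / (lam + 1) :=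
      div_pos (by linarith) (by linarith)
    refine ⟨min ((ε / (1 + ε) / (1 + lam)) ^ ρ / 2)
      (min 1 ((1 - (1 - ε) ^ ((1 - ρ) / ρ)) / (lam + 1))),
      lt_min (by linarith) (lt_min one_pos hB), ?_⟩
    intro a ha hle z _ h
    rw [le_min_iff, le_min_iff] at hle
    obtain ⟨i1, i2, i3⟩ := hle
    exact ⟨upper_part lam ρ hlam hρ0 hρ1 ε hε a ha (by linarith) z h,
      lower_part lam ρ hlam hρ0 hρ1 ε hε hε1 a ha i2 i3 z h⟩
  · refine ⟨(ε / (1 + ε) / (1 + lam)) ^ ρ / 2, by linarith, ?_⟩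
    intro a ha hle z hz h
    refine ⟨upper_part lam ρ hlam hρ0 hρ1 ε hε a ha (by linarith) z h, ?_⟩
    have hz0 : z ≠ 0 := by
      rintro rfl
      simp [Real.zero_rpow hs.ne'] at h
      exact ha.ne h
    have : 0 < ‖z‖ := norm_pos_iff.mpr hz0
    have ht0 : 0 < a ^ (1 / (1 - ρ)) := by positivity
    nlinarith
end

section
/- Let λ > 0 and 0 < ρ < 1. For every ε > 0 there exists A₀ > 0 such that for all A ≥ A₀ and every z ∈ ℂ with 1 + λz ≠ 0 satisfying |z|^{1−ρ}·|z−1|^ρ = A·|1+λz|^ρ, one has |z| > (1−ε)/λ and |z| < (1+ε)·λ^{ρ/(1−ρ)}·A^{1/(1−ρ)}. (As A → ∞ the level curve Γ_A = {z : |w(z)| = A} approaches the point z = −1/λ and infinity.) -/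
/-- as `A → ∞` the level curve `Γ_A = {z : |z|^{1-ρ}|z-1|^ρ/|1+λz|^ρ = A}`
approaches the point `z = -1/λ` and infinity: every `z ∈ Γ_A` satisfies `|z| > (1-ε)/λ` and
`|z| < (1+ε) λ^{ρ/(1-ρ)} A^{1/(1-ρ)}` once `A` is large enough. -/
theorem stmt15 (lam ρ : ℝ) (hlam : 0 < lam) (hρ0 : 0 < ρ) (hρ1 : ρ < 1)
    (ε : ℝ) (hε : 0 < ε) :
    ∃ A₀ > 0, ∀ A : ℝ, A₀ ≤ A → ∀ z : ℂ, 1 + (lam : ℂ) * z ≠ 0 →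
      ‖z‖ ^ (1 - ρ) * ‖z - 1‖ ^ ρ =
        A * ‖1 + (lam : ℂ) * z‖ ^ ρ →
      (1 - ε) / lam < ‖z‖ ∧
      ‖z‖ < (1 + ε) * lam ^ (ρ / (1 - ρ)) * A ^ (1 / (1 - ρ)) := by
  have ha : 0 < 1 - ρ := by linarith
  obtain ⟨q, hq⟩ : ∃ q, q = (1 + ε) ^ ((1 - ρ) / ρ) := ⟨_, rfl⟩
  have hq1 : 1 < q := by
    rw [hq]; exact Real.one_lt_rpow (by linarith) (by positivity)
  have hqρ : q ^ ρ = (1 + ε) ^ (1 - ρ) := by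
    rw [hq, ← Real.rpow_mul (by linarith), div_mul_cancel₀ _ hρ0.ne']
  obtain ⟨R, hR⟩ : ∃ R, R = (1 + q * lam) / ((q - 1) * lam) := ⟨_, rfl⟩
  have hden : 0 < (q - 1) * lam := mul_pos (by linarith) hlam
  have hR0 : 0 < R := by
    rw [hR]; exact div_pos (by nlinarith) hden
  have hlρ : 0 < lam ^ ρ := Real.rpow_pos_of_pos hlam _
  have hερ : 0 < ε ^ ρ := Real.rpow_pos_of_pos hε _
  have hl1 : 0 < 1 / lam := by positivity
  refine ⟨(2 + 1 / lam) / ε ^ ρ + (R + 1) ^ (1 - ρ) / lam ^ ρ, by positivity, ?_⟩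
  intro A hA z hz heq
  have hp1 : 0 < (2 + 1 / lam) / ε ^ ρ := by positivity
  have hp2 : 0 < (R + 1) ^ (1 - ρ) / lam ^ ρ := by positivity
  have hA0 : 0 < A := by linarith
  have hA1 : 2 + 1 / lam ≤ A * ε ^ ρ := by
    rw [← div_le_iff₀ hερ]; linarith
  have hA2 : (R + 1) ^ (1 - ρ) ≤ A * lam ^ ρ := by
    rw [← div_le_iff₀ hlρ]; linarith
  have hr0 : 0 ≤ ‖z‖ := norm_nonneg z
  have hlz : ‖(lam : ℂ) * z‖ = lam * ‖z‖ := by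
    rw [norm_mul, Complex.norm_real, Real.norm_of_nonneg hlam.le]
  constructor
  · by_contra! h
    have h1 : lam * ‖z‖ ≤ 1 - ε := by
      rw [le_div_iff₀ hlam] at h; linarith
    have h2 : ε ≤ ‖1 + (lam : ℂ) * z‖ := by
      have := norm_sub_norm_le (1 : ℂ) (-((lam : ℂ) * z))
      rw [norm_neg, hlz, norm_one, sub_neg_eq_add] at this
      linarith
    have h3 : ‖z‖ ≤ 1 / lam := by
      rw [le_div_iff₀ hlam]; linarith
    have h4 : ‖z - 1‖ ≤ 1 + ‖z‖ := by
      have := norm_sub_le z 1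
      rw [norm_one] at this; linarith
    have h5 : ‖z‖ ^ (1 - ρ) * ‖z - 1‖ ^ ρ ≤ 1 + ‖z‖ := by
      calc ‖z‖ ^ (1 - ρ) * ‖z - 1‖ ^ ρ ≤ (1 + ‖z‖) ^ (1 - ρ) * (1 + ‖z‖) ^ ρ := by
            gcongr; linarith
        _ = 1 + ‖z‖ := by
            rw [← Real.rpow_add (by linarith), sub_add_cancel, Real.rpow_one]
    have h6 : A * ε ^ ρ ≤ A * ‖1 + (lam : ℂ) * z‖ ^ ρ := by gcongr
    linarith
  · by_contra! h
    have h1 : A * (lam * q) ^ ρ ≤ ‖z‖ ^ (1 - ρ) := by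
      calc A * (lam * q) ^ ρ
          = ((1 + ε) * lam ^ (ρ / (1 - ρ)) * A ^ (1 / (1 - ρ))) ^ (1 - ρ) := by
            rw [Real.mul_rpow (by positivity) (by positivity),
              Real.mul_rpow (by positivity) (by positivity),
              Real.mul_rpow (by positivity) (by positivity),
              ← Real.rpow_mul hlam.le, ← Real.rpow_mul hA0.le,
              div_mul_cancel₀ _ ha.ne', div_mul_cancel₀ _ ha.ne', Real.rpow_one, hqρ]
            ring
        _ ≤ ‖z‖ ^ (1 - ρ) := by gcongr
    have h2 : R + 1 ≤ ‖z‖ := by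
      rw [← Real.rpow_le_rpow_iff (by linarith) hr0 ha]
      have : lam ^ ρ ≤ (lam * q) ^ ρ := by
        gcongr; nlinarith
      nlinarith
    have h3 : lam * q * ‖z - 1‖ ≤ ‖1 + (lam : ℂ) * z‖ := by
      rw [← Real.rpow_le_rpow_iff (by positivity) (by positivity) hρ0,
        Real.mul_rpow (by positivity) (by positivity)]
      refine le_of_mul_le_mul_left ?_ hA0
      rw [← heq, ← mul_assoc]
      gcongr
    have h4 : ‖1 + (lam : ℂ) * z‖ ≤ 1 + lam * ‖z‖ := by
      have := norm_add_le (1 : ℂ) ((lam : ℂ) * z)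
      rwa [norm_one, hlz] at this
    have h5 : ‖z‖ - 1 ≤ ‖z - 1‖ := by
      have := norm_sub_norm_le z 1
      rwa [norm_one] at this
    have h6 : lam * q * (‖z‖ - 1) ≤ lam * q * ‖z - 1‖ := by gcongr
    have h7 : ‖z‖ ≤ R := by
      rw [hR, le_div_iff₀ hden]; nlinarith
    linarith
end

section
/- Let 1 ≤ P < L be integers, 0 < λ < 1, and 0 < γ < ln(1/λ). Then there exist a₀ > 0 and A₀ > 0 such that for every 0 < a < a₀ and every A > A₀ there is no Z = (z_1,…,z_P) ∈ ℂ^P with the following three properties: (i) 1 + λz_i ≠ 0 and a^L ≤ |z_i|^{L−P}|z_i−1|^P/|1+λz_i|^P ≤ A^L for all i; (ii) for at least one i the quantity |z_i|^{L−P}|z_i−1|^P/|1+λz_i|^P equals a^L or A^L; (iii) g_i(Z) = h_i(Z) for all i = 1,…,P. (The Bethe polynomial system P_i(Z) = g_i(Z) − h_i(Z) has no zeroes on the boundary of the polycylinder Ω.) -/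
/-- `g_i(Z) = e^{-Lγ} z_i^{L-P} (z_i - 1)^P ∏_j z_j (1 + λ z_j)`. -/
noncomputable def gB (L P : ℕ) (lam γ : ℝ) (Z : Fin P → ℂ) (i : Fin P) : ℂ :=
  (Real.exp (-(L * γ)) : ℂ) * Z i ^ (L - P) * (Z i - 1) ^ P *
    ∏ j, Z j * (1 + (lam : ℂ) * Z j)

/-- `h_i(Z) = (-1)^{P-1} (1 + λ z_i)^P ∏_j (z_j - 1)`. -/
noncomputable def hB (L P : ℕ) (lam : ℝ) (Z : Fin P → ℂ) (i : Fin P) : ℂ :=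
  (-1 : ℂ) ^ (P - 1) * (1 + (lam : ℂ) * Z i) ^ P * ∏ j, (Z j - 1)

/-- `|w(z)|^L = |z|^{L-P}|z-1|^P / |1+λz|^P`. -/
noncomputable def wn (lam : ℝ) (L P : ℕ) (z : ℂ) : ℝ :=
  ‖z‖ ^ (L - P) * ‖z - 1‖ ^ P / ‖1 + (lam : ℂ) * z‖ ^ P

theorem aux_norm (L P : ℕ) (lam γ : ℝ) (Z : Fin P → ℂ) (i : Fin P)
    (h : gB L P lam γ Z i = hB L P lam Z i) :
    Real.exp (-(L * γ)) * (‖Z i‖ ^ (L - P) * ‖Z i - 1‖ ^ P) *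
      ((∏ j, ‖Z j‖) * ∏ j, ‖1 + (lam : ℂ) * Z j‖) =
    ‖1 + (lam : ℂ) * Z i‖ ^ P * ∏ j, ‖Z j - 1‖ := by
  have h2 := congrArg norm h
  unfold gB hB at h2
  simp only [norm_mul, norm_pow, norm_prod, norm_neg, norm_one, one_pow, one_mul,
    Complex.norm_real, Real.norm_eq_abs, Real.abs_exp, Finset.prod_mul_distrib] at h2
  rw [← h2]
  ring

theorem aux_prod (L P : ℕ) (hP : 1 ≤ P) (hPL : P < L) (lam γ : ℝ) (Z : Fin P → ℂ)
    (hz1 : ∀ i, Z i - 1 ≠ 0) (hl : ∀ i, 1 + (lam : ℂ) * Z i ≠ 0)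
    (h : ∀ i, gB L P lam γ Z i = hB L P lam Z i) :
    ∏ j, ‖Z j‖ = Real.exp γ ^ P := by
  have hp := Finset.prod_congr (rfl : (Finset.univ : Finset (Fin P)) = Finset.univ)
    (fun i _ => aux_norm L P lam γ Z i (h i))
  simp only [Finset.prod_mul_distrib, Finset.prod_const, Finset.card_univ, Fintype.card_fin,
    Finset.prod_pow] at hp
  have hV : 0 < ∏ j, ‖Z j - 1‖ := Finset.prod_pos fun j _ => norm_pos_iff.mpr (hz1 j)
  have hU : 0 < ∏ j, ‖1 + (lam : ℂ) * Z j‖ := Finset.prod_pos fun j _ => norm_pos_iff.mpr (hl j)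
  have hT : 0 ≤ ∏ j, ‖Z j‖ := Finset.prod_nonneg fun j _ => norm_nonneg _
  generalize (∏ j, ‖Z j - 1‖) = V at *
  generalize (∏ j, ‖1 + (lam : ℂ) * Z j‖) = U at *
  generalize (∏ j, ‖Z j‖) = T at *
  have hTL : T ^ (L - P) * T ^ P = T ^ L := by rw [← pow_add]; congr 1; omega
  have h3 : Real.exp (-(L * γ)) ^ P * T ^ L = 1 := by
    have hne : U ^ P * V ^ P ≠ 0 := by positivity
    apply mul_right_cancel₀ hne
    rw [← hTL, one_mul]
    refine Eq.trans ?_ hp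
    ring
  have h4 : Real.exp (-(L * γ)) ^ P * (Real.exp γ ^ P) ^ L = 1 := by
    rw [← pow_mul, ← Real.exp_nat_mul, ← Real.exp_nat_mul, ← Real.exp_add, ← Real.exp_zero]
    congr 1
    push_cast
    ring
  have h5 : T ^ L = (Real.exp γ ^ P) ^ L := by
    apply mul_left_cancel₀ (pow_pos (Real.exp_pos (-(L * γ))) P).ne'
    rw [h3, h4]
  exact (pow_left_inj₀ hT (by positivity) (by omega)).mp h5

theorem aux_low (L P : ℕ) (lam q : ℝ) (h0 : 0 < lam) (hq : 1 < q) (z : ℂ) (hz : q ≤ ‖z‖)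
    (hl : 1 + (lam : ℂ) * z ≠ 0) :
    ((q - 1) / (1 + lam * q)) ^ P ≤ wn lam L P z := by
  unfold wn
  have h2 : ‖z‖ - 1 ≤ ‖z - 1‖ := by simpa using norm_sub_norm_le z 1
  have h3 : ‖1 + (lam : ℂ) * z‖ ≤ 1 + lam * ‖z‖ := by
    refine (norm_add_le _ _).trans ?_
    simp [abs_of_pos h0]
  have h4 : 0 < ‖1 + (lam : ℂ) * z‖ := norm_pos_iff.mpr hl
  have h5 : (q - 1) / (1 + lam * q) ≤ ‖z - 1‖ / ‖1 + (lam : ℂ) * z‖ := by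
    calc (q - 1) / (1 + lam * q) ≤ (‖z‖ - 1) / (1 + lam * ‖z‖) := by
          rw [div_le_div_iff₀ (by positivity) (by positivity)]
          nlinarith
      _ ≤ ‖z - 1‖ / ‖1 + (lam : ℂ) * z‖ := by
          apply div_le_div₀ <;> first | assumption | positivity
  have h6 : 0 ≤ (q - 1) / (1 + lam * q) := div_nonneg (by linarith) (by positivity)
  rw [mul_div_assoc, ← div_pow]
  calc ((q - 1) / (1 + lam * q)) ^ P ≤ (‖z - 1‖ / ‖1 + (lam : ℂ) * z‖) ^ P :=
        pow_le_pow_left₀ h6 h5 P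
    _ ≤ _ := le_mul_of_one_le_left (by positivity) (one_le_pow₀ (by linarith))

theorem aux_high (L P : ℕ) (lam q : ℝ) (h0 : 0 < lam) (hlq : lam * q < 1) (z : ℂ)
    (hz : ‖z‖ ≤ q) :
    wn lam L P z ≤ q ^ (L - P) * (q + 1) ^ P / (1 - lam * q) ^ P := by
  unfold wn
  have hq : 0 ≤ q := (norm_nonneg z).trans hz
  have h2 : ‖z - 1‖ ≤ q + 1 := by
    refine (norm_sub_le _ _).trans ?_
    simpa using hz
  have h3 : 1 - lam * q ≤ ‖1 + (lam : ℂ) * z‖ := by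
    have := norm_sub_norm_le (1 : ℂ) (-((lam : ℂ) * z))
    simp [abs_of_pos h0] at this
    nlinarith
  have h4 : 0 < 1 - lam * q := by linarith
  gcongr

/-- the Bethe polynomial system `g_i(Z) = h_i(Z)` has no zeroes on the boundary
of the polycylinder `Ω` once `a` is small and `A` is large. -/
theorem stmt16 (L P : ℕ) (hP : 1 ≤ P) (hPL : P < L) (lam : ℝ) (h0 : 0 < lam) (h1 : lam < 1)
    (γ : ℝ) (hγ0 : 0 < γ) (hγ1 : γ < Real.log (1 / lam)) :
    ∃ a₀ > 0, ∃ A₀ > 0, ∀ a A : ℝ, 0 < a → a < a₀ → A₀ < A →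
      ¬ ∃ Z : Fin P → ℂ,
        (∀ i, 1 + (lam : ℂ) * Z i ≠ 0 ∧
          a ^ L ≤ wn lam L P (Z i) ∧ wn lam L P (Z i) ≤ A ^ L) ∧
        (∃ i, wn lam L P (Z i) = a ^ L ∨ wn lam L P (Z i) = A ^ L) ∧
        (∀ i, gB L P lam γ Z i = hB L P lam Z i) := by
  have hq1 : 1 < Real.exp γ := Real.one_lt_exp_iff.mpr hγ0
  have hlq : lam * Real.exp γ < 1 := by
    have := (Real.lt_log_iff_exp_lt (by positivity)).mp hγ1
    rw [lt_div_iff₀ h0] at this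
    linarith
  set q := Real.exp γ with hq
  have hc : 0 < ((q - 1) / (1 + lam * q)) ^ P :=
    pow_pos (div_pos (by linarith) (by positivity)) P
  refine ⟨min 1 (((q - 1) / (1 + lam * q)) ^ P), lt_min one_pos hc,
    max 1 (q ^ (L - P) * (q + 1) ^ P / (1 - lam * q) ^ P), lt_max_of_lt_left one_pos, ?_⟩
  rintro a A ha ha0 hA0 ⟨Z, hZ, ⟨i, hi⟩, hgh⟩
  obtain ⟨ha1, hac⟩ := lt_min_iff.mp ha0
  obtain ⟨hA1, hAc⟩ := max_lt_iff.mp hA0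
  have hL : L ≠ 0 := by omega
  have haL : a ^ L ≤ a := pow_le_of_le_one ha.le ha1.le hL
  have hAL : A ≤ A ^ L := le_self_pow₀ hA1.le hL
  have hpos : ∀ i, 0 < wn lam L P (Z i) := fun i => (pow_pos ha L).trans_le (hZ i).2.1
  have hz1 : ∀ i, Z i - 1 ≠ 0 := by
    intro i h
    have := hpos i
    unfold wn at this
    rw [h, norm_zero, zero_pow (by omega)] at this
    simp at this
  have hz0 : ∀ i, Z i ≠ 0 := by
    intro i h
    have := hpos i
    unfold wn at this
    rw [h, norm_zero, zero_pow (by omega)] at this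
    simp at this
  have hl : ∀ i, 1 + (lam : ℂ) * Z i ≠ 0 := fun i => (hZ i).1
  have hprod := aux_prod L P hP hPL lam γ Z hz1 hl hgh
  have hU : 0 < ∏ j, ‖1 + (lam : ℂ) * Z j‖ := Finset.prod_pos fun j _ => norm_pos_iff.mpr (hl j)
  have hT : 0 < ∏ j, ‖Z j‖ := Finset.prod_pos fun j _ => norm_pos_iff.mpr (hz0 j)
  have hE := Real.exp_pos (-(L * γ))
  have hw : ∀ i, wn lam L P (Z i) = (∏ j, ‖Z j - 1‖) /
      (Real.exp (-(L * γ)) * ((∏ j, ‖Z j‖) * ∏ j, ‖1 + (lam : ℂ) * Z j‖)) := by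
    intro i
    have h := aux_norm L P lam γ Z i (hgh i)
    have h4 : 0 < ‖1 + (lam : ℂ) * Z i‖ ^ P := pow_pos (norm_pos_iff.mpr (hl i)) P
    unfold wn
    rw [div_eq_div_iff h4.ne' (by positivity)]
    linarith
  have hcard : ∏ _j : Fin P, q = q ^ P := by simp
  have hne : (Finset.univ : Finset (Fin P)).Nonempty := ⟨i, Finset.mem_univ i⟩
  rcases hi with hi | hi
  · obtain ⟨k, hk⟩ : ∃ k, q ≤ ‖Z k‖ := by
      by_contra! hcon
      have := Finset.prod_lt_prod_of_nonempty (s := Finset.univ)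
        (fun j _ => norm_pos_iff.mpr (hz0 j)) (fun j _ => hcon j) hne
      rw [hcard, hprod] at this
      exact lt_irrefl _ this
    have := aux_low L P lam q h0 hq1 (Z k) hk (hl k)
    rw [hw k, ← hw i, hi] at this
    linarith
  · obtain ⟨k, hk⟩ : ∃ k, ‖Z k‖ ≤ q := by
      by_contra! hcon
      have := Finset.prod_lt_prod_of_nonempty (s := Finset.univ)
        (fun _ _ => Real.exp_pos γ) (fun j _ => hcon j) hne
      rw [hcard, hprod] at this
      exact lt_irrefl _ this
    have := aux_high L P lam q h0 hlq (Z k) hk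
    rw [hw k, ← hw i, hi] at this
    linarith
end

section
/- Let P ≥ 1 and L be integers with 2P ≤ L, let 0 < λ < 1 and 0 < γ < ln(1/λ). Then for every a₁ > 0 and A₁ > 0 there exist a ∈ (0, a₁) and A > A₁ such that for every Z = (z_1,…,z_P) ∈ ℂ^P with each coordinate satisfying 1 + λz_i ≠ 0 and either |z_i|^{L−P}|z_i−1|^P/|1+λz_i|^P = a^L or |z_i|^{L−P}|z_i−1|^P/|1+λz_i|^P = A^L, one has for every i: |g_i(Z)| < |h_i(Z)| if |z_i|^{L−P}|z_i−1|^P/|1+λz_i|^P = a^L, and |g_i(Z)| > |h_i(Z)| if |z_i|^{L−P}|z_i−1|^P/|1+λz_i|^P = A^L. -/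
lemma aux_a_up (P n : ℕ) (hP : 1 ≤ P) (x y u a lam E : ℝ) (hE : 1 < E) (hx : E ≤ x)
    (hy : x - 1 ≤ y) (hu0 : 0 < u) (hu : u ≤ 1 + lam * x) (h0 : 0 < lam) (h1 : lam < 1)
    (ha : 0 < a) (ha1 : a < 1) (hc : a * (1 + lam * E) < E - 1) :
    a ^ (2 * P + n) * u ^ P < x ^ (P + n) * y ^ P := by
  have hal : a * lam < 1 := by nlinarith
  have h2 : a * u < y := by
    have : a * u ≤ a * (1 + lam * x) := by gcongr
    nlinarith [mul_nonneg (sub_nonneg.2 hx) (sub_nonneg.2 hal.le)]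
  have h3 : (a * u) ^ P < y ^ P := by gcongr
  have hyp : 0 < y := lt_trans (by positivity) h2
  have h4 : a ^ (2 * P + n) ≤ a ^ P := pow_le_pow_of_le_one ha.le ha1.le (by omega)
  have h5 : 1 ≤ x ^ (P + n) := one_le_pow₀ (by linarith)
  calc a ^ (2 * P + n) * u ^ P ≤ a ^ P * u ^ P := by gcongr
    _ = (a * u) ^ P := by rw [mul_pow]
    _ < y ^ P := h3
    _ ≤ x ^ (P + n) * y ^ P := le_mul_of_one_le_left (by positivity) h5

lemma aux_a_low (P n : ℕ) (hP : 1 ≤ P) (x y u a r : ℝ) (hr0 : 0 < r) (hr1 : r < 1)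
    (hx0 : 0 ≤ x) (hx : x ≤ a ^ 2 * r) (hy0 : 0 ≤ y)
    (hy : y ≤ 1 + x) (hu : 1 - r ^ 2 * x ≤ u)
    (ha : 0 < a) (ha1 : a < 1) (hc : r * (1 + a ^ 2) < 1 - a ^ 2) :
    x ^ (P + n) * y ^ P < a ^ (2 * P + n) * u ^ P := by
  have ha2 : 0 < a ^ 2 := by positivity
  have hxa : x ≤ a ^ 2 := by nlinarith
  have h2 : r * y < u := by
    have e1 : r * y ≤ r * (1 + a ^ 2) := by gcongr; linarith
    have e2 : r ^ 2 * x ≤ 1 * a ^ 2 := by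
      gcongr; nlinarith
    linarith
  have hu0 : 0 < u := lt_of_le_of_lt (by positivity) h2
  have h3 : (r * y) ^ P < u ^ P := by gcongr
  calc x ^ (P + n) * y ^ P ≤ (a ^ 2 * r) ^ (P + n) * y ^ P := by gcongr
    _ = a ^ (2 * P + n) * a ^ n * (r ^ n * (r * y) ^ P) := by ring
    _ ≤ a ^ (2 * P + n) * 1 * (1 * (r * y) ^ P) := by
        gcongr
        · exact pow_le_one₀ ha.le ha1.le
        · exact pow_le_one₀ hr0.le hr1.le
    _ = a ^ (2 * P + n) * (r * y) ^ P := by ring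
    _ < a ^ (2 * P + n) * u ^ P := by gcongr

lemma aux_A_low (P n : ℕ) (hP : 1 ≤ P) (x y u A lam E : ℝ) (hE : 1 < E) (hx0 : 0 ≤ x)
    (hx : x ≤ E) (hy0 : 0 ≤ y) (hy : y ≤ 1 + x) (hu : 1 - lam * x ≤ u) (h0 : 0 < lam)
    (hlE : lam * E < 1) (hA : E * (1 + E) < A * (1 - lam * E)) :
    x ^ (P + n) * y ^ P < A ^ (2 * P + n) * u ^ P := by
  have hq : 0 < 1 - lam * E := by linarith
  have hq1 : 1 - lam * E < 1 := by nlinarith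
  have hA0 : 0 < A := by
    by_contra h
    nlinarith
  have hAE : E ≤ A := by nlinarith
  have hul : 1 - lam * E ≤ u := by nlinarith
  have hu0 : 0 < u := by linarith
  have h2 : y < A * u := by nlinarith
  have h3 : y ^ P < (A * u) ^ P := by gcongr
  calc x ^ (P + n) * y ^ P ≤ A ^ (P + n) * y ^ P := by gcongr; linarith
    _ < A ^ (P + n) * (A * u) ^ P := by gcongr
    _ = A ^ (2 * P + n) * u ^ P := by ring

lemma aux_A_up (P n : ℕ) (hP : 1 ≤ P) (x y u A r : ℝ) (hr0 : 0 < r) (hr1 : r < 1)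
    (hA0 : 0 < A) (hx : r * A ^ 2 ≤ x) (hy : x - 1 ≤ y) (hu0 : 0 < u) (hu : u ≤ 1 + r ^ 2 * x)
    (hrA : 1 ≤ r * A) (hA : 1 + r < r * A ^ 2 * (r - r ^ 2)) :
    A ^ (2 * P + n) * u ^ P < x ^ (P + n) * y ^ P := by
  have hrr : 0 < r - r ^ 2 := by nlinarith
  have h2 : u < r * y := by
    have := mul_le_mul_of_nonneg_right hx hrr.le
    nlinarith
  have hy0 : 0 < y := by
    by_contra h
    nlinarith
  have h3 : u ^ P < (r * y) ^ P := by gcongr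
  have h4 : A ≤ x := by nlinarith
  calc A ^ (2 * P + n) * u ^ P < A ^ (2 * P + n) * (r * y) ^ P := by gcongr
    _ = (r * A ^ 2) ^ P * A ^ n * y ^ P := by ring
    _ ≤ x ^ P * x ^ n * y ^ P := by
        have hx0 : 0 < x := by linarith
        gcongr
    _ = x ^ (P + n) * y ^ P := by ring

lemma aux_choose (lam γ a₁ A₁ r : ℝ) (hr0 : 0 < r) (hr1 : r < 1) (hl : lam = r ^ 2)
    (E T : ℝ) (hE : 1 < E) (hT : 0 < T) (ha₁ : 0 < a₁) (hlE : lam * E < 1) :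
    ∃ a : ℝ, 0 < a ∧ a < a₁ ∧ a < 1 ∧ A₁ * a < T ∧ r * (1 + a ^ 2) < 1 - a ^ 2 ∧
      a * (1 + lam * E) < E - 1 ∧ E * (1 + E) * a < T * (1 - lam * E) ∧ a < r * T ∧
      (1 + r) * a ^ 2 < r * T ^ 2 * (r - r ^ 2) := by
  have key : ∀ f g : ℝ → ℝ, Continuous f → Continuous g → f 0 < g 0 →
      ∀ᶠ a in nhdsWithin (0 : ℝ) (Set.Ioi 0), f a < g a := by
    intro f g hf hg h
    exact ((hf.tendsto 0).eventually_lt (hg.tendsto 0) h).filter_mono nhdsWithin_le_nhds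
  have hrr : 0 < r - r ^ 2 := by nlinarith
  have e0 : ∀ᶠ a in nhdsWithin (0 : ℝ) (Set.Ioi 0), 0 < a := self_mem_nhdsWithin
  have e1 := key (fun a => a) (fun _ => a₁) (by fun_prop) (by fun_prop) (by simpa)
  have e2 := key (fun a => a) (fun _ => 1) (by fun_prop) (by fun_prop) (by simp)
  have e3 := key (fun a => A₁ * a) (fun _ => T) (by fun_prop) (by fun_prop) (by simpa)
  have e4 := key (fun a => r * (1 + a ^ 2)) (fun a => 1 - a ^ 2) (by fun_prop) (by fun_prop)
    (by simpa)
  have e5 := key (fun a => a * (1 + lam * E)) (fun _ => E - 1) (by fun_prop) (by fun_prop)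
    (by simpa)
  have e6 := key (fun a => E * (1 + E) * a) (fun _ => T * (1 - lam * E)) (by fun_prop)
    (by fun_prop) (by simp; exact mul_pos hT (by linarith))
  have e7 := key (fun a => a) (fun _ => r * T) (by fun_prop) (by fun_prop) (by positivity)
  have e8 := key (fun a => (1 + r) * a ^ 2) (fun _ => r * T ^ 2 * (r - r ^ 2)) (by fun_prop)
    (by fun_prop) (by simp; positivity)
  obtain ⟨a, h⟩ := (e0.and (e1.and (e2.and (e3.and (e4.and (e5.and (e6.and (e7.and e8)))))))).exists
  exact ⟨a, h⟩

lemma aux_norms (lam : ℝ) (h0 : 0 < lam) (z : ℂ) :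
    ‖z‖ - 1 ≤ ‖z - 1‖ ∧ ‖z - 1‖ ≤ 1 + ‖z‖ ∧ ‖1 + (lam : ℂ) * z‖ ≤ 1 + lam * ‖z‖ ∧
      1 - lam * ‖z‖ ≤ ‖1 + (lam : ℂ) * z‖ := by
  have hn : ‖(lam : ℂ) * z‖ = lam * ‖z‖ := by
    rw [norm_mul, Complex.norm_real, Real.norm_of_nonneg h0.le]
  refine ⟨?_, ?_, ?_, ?_⟩
  · simpa using norm_sub_norm_le z 1
  · have := norm_sub_le z 1
    simp at this; linarith
  · have := norm_add_le (1 : ℂ) (lam * z)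
    rw [hn] at this; simpa using this
  · have := norm_sub_le (1 + (lam : ℂ) * z) (lam * z)
    rw [hn] at this; simp at this; linarith

/-- Identity behind the comparison of the two sides. -/
lemma aux_ratio (P n : ℕ) (x y u w E s : ℝ) (hy : y ≠ 0) (hw : w ≠ 0) (hE : E ≠ 0)
    (h : x ^ (P + n) * y ^ P = w ^ (2 * P + n) * u ^ P) :
    (E⁻¹) ^ (2 * P + n) * s ^ (2 * P + n) * (x * u / y) ^ P
      = (E⁻¹ * x * s / w) ^ (2 * P + n) := by
  have : (x * u / y) ^ P = x ^ (2 * P + n) / w ^ (2 * P + n) := by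
    rw [div_pow, div_eq_div_iff (by positivity) (by positivity)]
    calc (x * u) ^ P * w ^ (2 * P + n) = x ^ P * (w ^ (2 * P + n) * u ^ P) := by ring
      _ = x ^ (2 * P + n) * y ^ P := by rw [← h]; ring
  rw [this, div_pow, mul_pow, mul_pow]
  ring

lemma aux_prod_lt (P : ℕ) (hP : 1 ≤ P) (C : ℝ) (hC : 0 < C) (φ : Fin P → ℝ) (hφ : ∀ j, 0 < φ j)
    (h : ∀ j, C * φ j ^ P < 1) : C * ∏ j, φ j < 1 := by
  have hp : 0 < ∏ j, φ j := Finset.prod_pos fun j _ => hφ j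
  have : (C * ∏ j, φ j) ^ P = ∏ j, (C * φ j ^ P) := by
    rw [Finset.prod_mul_distrib, mul_pow, Finset.prod_pow]; simp
  have h2 : (C * ∏ j, φ j) ^ P < 1 := by
    rw [this]
    have : ∏ j : Fin P, (C * φ j ^ P) < ∏ j : Fin P, (1 : ℝ) :=
      Finset.prod_lt_prod_of_nonempty (fun j _ => by have := hφ j; positivity) (fun j _ => h j)
        ⟨⟨0, by omega⟩, Finset.mem_univ _⟩
    simpa using this
  by_contra hc
  exact absurd (one_le_pow₀ (not_lt.1 hc)) (not_le.2 h2)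

lemma aux_prod_gt (P : ℕ) (hP : 1 ≤ P) (C : ℝ) (hC : 0 < C) (φ : Fin P → ℝ) (hφ : ∀ j, 0 < φ j)
    (h : ∀ j, 1 < C * φ j ^ P) : 1 < C * ∏ j, φ j := by
  have hp : 0 < ∏ j, φ j := Finset.prod_pos fun j _ => hφ j
  have := aux_prod_lt P hP C⁻¹ (by positivity) (fun j => (φ j)⁻¹)
    (fun j => by have := hφ j; positivity) (fun j => by
      rw [inv_pow, ← mul_inv]; exact inv_lt_one_of_one_lt₀ (h j))
  rw [Finset.prod_inv_distrib, ← mul_inv] at this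
  exact (inv_lt_one₀ (by positivity)).1 this

/-- for `ρ = P/L ≤ 1/2`, `0 < λ < 1`, `0 < γ < ln(1/λ)`, the contours can be chosen
with arbitrarily small `a` and large `A` so that `|g_i| < |h_i|` on `Γ_a` and `|g_i| > |h_i|`
on `Γ_A`. -/
theorem stmt17 (L P : ℕ) (hP : 1 ≤ P) (hPL : 2 * P ≤ L) (lam : ℝ) (h0 : 0 < lam) (h1 : lam < 1)
    (γ : ℝ) (hγ0 : 0 < γ) (hγ1 : γ < Real.log (1 / lam))
    (a₁ A₁ : ℝ) (ha₁ : 0 < a₁) (hA₁ : 0 < A₁) :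
    ∃ a : ℝ, 0 < a ∧ a < a₁ ∧ ∃ A : ℝ, A₁ < A ∧
      ∀ Z : Fin P → ℂ,
        (∀ i, 1 + (lam : ℂ) * Z i ≠ 0 ∧
          (wn lam L P (Z i) = a ^ L ∨ wn lam L P (Z i) = A ^ L)) →
        ∀ i, (wn lam L P (Z i) = a ^ L →
              ‖gB L P lam γ Z i‖ < ‖hB L P lam Z i‖) ∧
             (wn lam L P (Z i) = A ^ L →
              ‖hB L P lam Z i‖ < ‖gB L P lam γ Z i‖) := by
  obtain ⟨n, rfl⟩ : ∃ n, L = 2 * P + n := ⟨L - 2 * P, by omega⟩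
  have hsub : 2 * P + n - P = P + n := by omega
  set L := 2 * P + n with hL
  have hLne : L ≠ 0 := by omega
  set r := Real.sqrt lam with hr
  have hr0 : 0 < r := Real.sqrt_pos.2 h0
  have hlr : lam = r ^ 2 := (Real.sq_sqrt h0.le).symm
  have hr1 : r < 1 := by nlinarith
  set E := Real.exp γ with hEdef
  have hE : 1 < E := Real.one_lt_exp_iff.2 hγ0
  have hE0 : 0 < E := by linarith
  have hlE : lam * E < 1 := by
    have : E < 1 / lam := (Real.lt_log_iff_exp_lt (by positivity)).1 hγ1
    rw [lt_div_iff₀ h0] at this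
    linarith
  set T := E / r with hTdef
  have hT : 0 < T := by positivity
  have hrT : r * T = E := by rw [hTdef]; field_simp
  obtain ⟨a, ha, haa, ha1, hc1, hc2, hc3, hc4, hc5, hc6⟩ :=
    aux_choose lam γ a₁ A₁ r hr0 hr1 hlr E T hE hT ha₁ hlE
  obtain ⟨A, hAdef⟩ : ∃ A, A = T / a := ⟨_, rfl⟩
  have hTA : T = A * a := by rw [hAdef]; field_simp
  have hA0 : 0 < A := by rw [hAdef]; positivity
  refine ⟨a, ha, haa, A, by rw [hAdef, lt_div_iff₀ ha]; exact hc1, ?_⟩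
  have hd4 : E * (1 + E) < A * (1 - lam * E) := by
    rw [hTA] at hc4
    refine lt_of_mul_lt_mul_right ?_ ha.le
    linarith
  have hd5 : 1 ≤ r * A := by
    rw [hTA] at hc5
    by_contra h
    nlinarith
  have hd6 : 1 + r < r * A ^ 2 * (r - r ^ 2) := by
    rw [hTA] at hc6
    refine lt_of_mul_lt_mul_right ?_ (sq_nonneg a)
    linarith
  intro Z hZ
  have hraA : r * A * a = E := by rw [← hrT, hTA]; ring
  -- pointwise data
  have hpt : ∀ j, 0 < ‖Z j‖ ∧ 0 < ‖Z j - 1‖ ∧ 0 < ‖1 + (lam : ℂ) * Z j‖ ∧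
      E⁻¹ ^ L * a ^ L * (‖Z j‖ * ‖1 + (lam : ℂ) * Z j‖ / ‖Z j - 1‖) ^ P < 1 ∧
      1 < E⁻¹ ^ L * A ^ L * (‖Z j‖ * ‖1 + (lam : ℂ) * Z j‖ / ‖Z j - 1‖) ^ P := by
    intro j
    obtain ⟨hne, hor⟩ := hZ j
    have hu0 : 0 < ‖1 + (lam : ℂ) * Z j‖ := norm_pos_iff.2 hne
    obtain ⟨n1, n2, n3, n4⟩ := aux_norms lam h0 (Z j)
    have hx0 := norm_nonneg (Z j)
    have hy0 := norm_nonneg (Z j - 1)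
    simp only [wn, hsub] at hor
    generalize ‖Z j‖ = x at *
    generalize ‖Z j - 1‖ = y at *
    generalize ‖1 + (lam : ℂ) * Z j‖ = u at *
    rw [div_eq_iff (by positivity), div_eq_iff (by positivity)] at hor
    have hpos : 0 < x ^ (P + n) * y ^ P := by
      rcases hor with h | h <;> rw [h] <;> positivity
    have hx : 0 < x := by
      rcases hx0.eq_or_lt with h | h
      · rw [← h, zero_pow (by omega)] at hpos; simp at hpos
      · exact h
    have hy : 0 < y := by
      rcases hy0.eq_or_lt with h | h
      · rw [← h, zero_pow (n := P) (by omega)] at hpos; simp at hpos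
      · exact h
    refine ⟨hx, hy, hu0, ?_⟩
    rcases hor with h | h
    · rw [aux_ratio P n x y u a E a hy.ne' ha.ne' hE0.ne' h,
        aux_ratio P n x y u a E A hy.ne' ha.ne' hE0.ne' h]
      constructor
      · apply pow_lt_one₀ (by positivity) _ hLne
        rw [mul_div_assoc, div_self ha.ne', mul_one, inv_mul_lt_iff₀ hE0, mul_one]
        by_contra hcon
        exact absurd h (aux_a_up P n hP x y u a lam E hE (not_lt.1 hcon) n1 hu0 n3 h0 h1 ha ha1
          hc3).ne'
      · apply one_lt_pow₀ _ hLne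
        rw [lt_div_iff₀ ha, one_mul, mul_assoc, lt_inv_mul_iff₀ hE0]
        have : a ^ 2 * r < x := by
          by_contra hcon
          exact absurd h (aux_a_low P n hP x y u a r hr0 hr1 hx.le (not_lt.1 hcon) hy.le n2
            (by rw [← hlr]; exact n4) ha ha1 hc2).ne
        calc E * a = a ^ 2 * r * A := by rw [← hraA]; ring
          _ < x * A := by gcongr
    · rw [aux_ratio P n x y u A E a hy.ne' hA0.ne' hE0.ne' h,
        aux_ratio P n x y u A E A hy.ne' hA0.ne' hE0.ne' h]
      constructor
      · apply pow_lt_one₀ (by positivity) _ hLne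
        rw [div_lt_iff₀ hA0, one_mul, mul_assoc, inv_mul_lt_iff₀ hE0]
        have : x < r * A ^ 2 := by
          by_contra hcon
          exact absurd h (aux_A_up P n hP x y u A r hr0 hr1 hA0 (not_lt.1 hcon) n1 hu0
            (by rw [← hlr]; exact n3) hd5 hd6).ne'
        calc x * a < r * A ^ 2 * a := by gcongr
          _ = E * A := by rw [← hraA]; ring
      · apply one_lt_pow₀ _ hLne
        rw [mul_div_assoc, div_self hA0.ne', mul_one, lt_inv_mul_iff₀ hE0, mul_one]
        by_contra hcon
        exact absurd h (aux_A_low P n hP x y u A lam E hE hx.le (not_lt.1 hcon) hy.le n2 n4 h0 hlE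
          hd4).ne
  have hexp : Real.exp (-((L : ℝ) * γ)) = E⁻¹ ^ L := by
    rw [hEdef, ← Real.exp_neg, ← Real.exp_nat_mul]; congr 1; ring
  intro i
  have hui := (hpt i).2.2.1
  have hprody : 0 < ∏ j, ‖Z j - 1‖ := Finset.prod_pos fun j _ => (hpt j).2.1
  have hh : ‖hB L P lam Z i‖ = ‖1 + (lam : ℂ) * Z i‖ ^ P * ∏ j, ‖Z j - 1‖ := by
    simp [hB, norm_prod]
  have hg : ‖gB L P lam γ Z i‖ = E⁻¹ ^ L * wn lam L P (Z i) *
      (∏ j, (‖Z j‖ * ‖1 + (lam : ℂ) * Z j‖ / ‖Z j - 1‖)) * ‖hB L P lam Z i‖ := by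
    rw [hh, Finset.prod_div_distrib]
    have : ‖gB L P lam γ Z i‖ = E⁻¹ ^ L * (‖Z i‖ ^ (L - P) * ‖Z i - 1‖ ^ P) *
        ∏ j, (‖Z j‖ * ‖1 + (lam : ℂ) * Z j‖) := by
      rw [gB, norm_mul, norm_mul, norm_mul, norm_prod, norm_pow, norm_pow, Complex.norm_real,
        Real.norm_of_nonneg (Real.exp_pos _).le, hexp]
      simp only [norm_mul]
      ring
    rw [this, wn]
    generalize ‖1 + (lam : ℂ) * Z i‖ = u at *
    generalize (∏ j, ‖Z j - 1‖) = q at *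
    field_simp
  have hhpos : 0 < ‖hB L P lam Z i‖ := by rw [hh]; positivity
  have hφ : ∀ j, 0 < ‖Z j‖ * ‖1 + (lam : ℂ) * Z j‖ / ‖Z j - 1‖ := fun j =>
    div_pos (mul_pos (hpt j).1 (hpt j).2.2.1) (hpt j).2.1
  constructor
  · intro hw
    rw [hg, hw]
    exact mul_lt_of_lt_one_left hhpos
      (aux_prod_lt P hP _ (by positivity) _ hφ fun j => (hpt j).2.2.2.1)
  · intro hw
    rw [hg, hw]
    exact lt_mul_of_one_lt_left hhpos
      (aux_prod_gt P hP _ (by positivity) _ hφ fun j => (hpt j).2.2.2.2)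
end
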